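/- arXiv:2205.13432 — 2 statements merged into one kernel-verified Lean document; each statement's English description precedes it below -/
import Mathlib

section
/- After removing the directed edge a⋆ → b, for all a, a' ∈ nd(b) one has Σ⋆ a a' = Σ a a'; that is, the covariance matrix restricted to the non-descendants of b is unchanged. -/
open Matrix

attribute [local instance] Classical.propDecidable

namespace EdgeIntervention

variable {n : ℕ}

/-- Descendants of `b` (including `b`): vertices reachable under the edge relation of `D`. -/
def desc (D : Set (Fin n × Fin n)) (b : Fin n) : Set (Fin n) :=
  {c | Relation.ReflTransGen (fun i j => (i, j) ∈ D) b c}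

/-- Ancestors of `c` (including `c`). -/
def anc (D : Set (Fin n × Fin n)) (c : Fin n) : Set (Fin n) :=
  {i | c ∈ desc D i}

/-- Descendants of `b` in the induced subgraph on `W`. -/
def descW (D : Set (Fin n × Fin n)) (W : Set (Fin n)) (b : Fin n) : Set (Fin n) :=
  {c | Relation.ReflTransGen (fun i j => (i, j) ∈ D ∧ i ∈ W ∧ j ∈ W) b c}

/-- District of `b` in the induced subgraph on `W`. -/
def disW (B : Set (Fin n × Fin n)) (W : Set (Fin n)) (b : Fin n) : Set (Fin n) :=
  {c | Relation.ReflTransGen (fun i j => (i, j) ∈ B ∧ i ∈ W ∧ j ∈ W) b c}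

/-- Markov blanket of `b` in the induced subgraph on `W`. -/
def mbW (D B : Set (Fin n × Fin n)) (W : Set (Fin n)) (b : Fin n) : Set (Fin n) :=
  (disW B W b ∪ {i | i ∈ W ∧ ∃ d ∈ disW B W b, (i, d) ∈ D}) \ {b}

/-- `Λ` is supported on the directed edge set `D`. -/
def DSupported (D : Set (Fin n × Fin n)) (Λ : Matrix (Fin n) (Fin n) ℝ) : Prop :=
  ∀ i j, (i, j) ∉ D → Λ i j = 0

/-- `Ω` is compatible with the bidirected edge set `B`: symmetric, positive definite,
and vanishing off the diagonal and off `B`. -/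
def BCompatible (B : Set (Fin n × Fin n)) (Ω : Matrix (Fin n) (Fin n) ℝ) : Prop :=
  Ω.IsSymm ∧ Ω.PosDef ∧ ∀ i j, i ≠ j → (i, j) ∉ B → Ω i j = 0

/-- The covariance matrix `Σ = ((1 - Λ)⁻¹)ᵀ * Ω * (1 - Λ)⁻¹` of the linear SEM. -/
noncomputable def cov (Λ Ω : Matrix (Fin n) (Fin n) ℝ) : Matrix (Fin n) (Fin n) ℝ :=
  ((1 - Λ)⁻¹)ᵀ * Ω * (1 - Λ)⁻¹

/-- Sum over all directed paths from `i` to `j` of their weights.  A path with `k` edges is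
encoded as `f : Fin (k+1) → Fin n` with all steps in `D`; since edges strictly increase,
every directed path has at most `n` edges, so `k` ranges over `Finset.range (n+1)`. -/
noncomputable def pathSum (D : Set (Fin n × Fin n)) (Λ : Matrix (Fin n) (Fin n) ℝ)
    (i j : Fin n) : ℝ :=
  ∑ k ∈ Finset.range (n + 1),
    ∑ f ∈ Finset.univ.filter
        (fun f : Fin (k + 1) → Fin n =>
          f 0 = i ∧ f (Fin.last k) = j ∧ ∀ t : Fin k, (f t.castSucc, f t.succ) ∈ D),
      ∏ t : Fin k, Λ (f t.castSucc) (f t.succ)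

/-- Conditional covariance `σ_{vw·S} = Σ v w − Σ_{vS} (Σ_{SS})⁻¹ Σ_{Sw}`. -/
noncomputable def condCov (Cov : Matrix (Fin n) (Fin n) ℝ) (S : Set (Fin n))
    (v w : Fin n) : ℝ :=
  letI := (Set.toFinite S).fintype
  Cov v w - ∑ i : S, ∑ j : S,
    Cov v i.val * (Cov.submatrix (Subtype.val : S → Fin n) Subtype.val)⁻¹ i j * Cov j.val w

/-- Regression coefficient `β_{vw·S} = σ_{vw·S} / σ_{vv·S}`. -/
noncomputable def regCoef (Cov : Matrix (Fin n) (Fin n) ℝ) (S : Set (Fin n))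
    (v w : Fin n) : ℝ :=
  condCov Cov S v w / condCov Cov S v v

/-- The matrix obtained from `Λ` by setting the `(a,b)` entry to `0`
(removal of the directed edge `a → b`). -/
def removeEdge (Λ : Matrix (Fin n) (Fin n) ℝ) (a b : Fin n) : Matrix (Fin n) (Fin n) ℝ :=
  Matrix.of fun i j => if i = a ∧ j = b then 0 else Λ i j

/-- The matrix obtained from `Ω` by setting the `(a,b)` and `(b,a)` entries to `0`
(removal of the bidirected edge `a ↔ b`). -/
def removeBi (Ω : Matrix (Fin n) (Fin n) ℝ) (a b : Fin n) : Matrix (Fin n) (Fin n) ℝ :=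
  Matrix.of fun i j => if (i = a ∧ j = b) ∨ (i = b ∧ j = a) then 0 else Ω i j

theorem DSupported.removeEdge {D : Set (Fin n × Fin n)} {Λ : Matrix (Fin n) (Fin n) ℝ}
    (hΛ : DSupported D Λ) (a b : Fin n) : DSupported D (removeEdge Λ a b) := by
  intro i j hij
  simp [EdgeIntervention.removeEdge, hΛ i j hij]

theorem DSupported.isUnit_det_one_sub {D : Set (Fin n × Fin n)}
    (hD : ∀ i j : Fin n, (i, j) ∈ D → i < j) {Λ : Matrix (Fin n) (Fin n) ℝ}
    (hΛ : DSupported D Λ) : IsUnit (1 - Λ).det := by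
  have hzero : ∀ i j : Fin n, j ≤ i → Λ i j = 0 := fun i j hji =>
    hΛ i j fun hij => (hD i j hij).not_ge hji
  rw [Matrix.det_of_isUpperTriangular]
  · simp [hzero]
  · intro i j hji
    have hji : j < i := hji
    simp [hzero i j hji.le, Matrix.one_apply_ne hji.ne']

/-- The columns of `(1 - Λ)⁻¹` satisfy the structural recursion. -/
theorem DSupported.inv_one_sub_apply {D : Set (Fin n × Fin n)}
    (hD : ∀ i j : Fin n, (i, j) ∈ D → i < j) {Λ : Matrix (Fin n) (Fin n) ℝ}
    (hΛ : DSupported D Λ) (i j : Fin n) :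
    (1 - Λ)⁻¹ i j = (1 : Matrix (Fin n) (Fin n) ℝ) i j + ∑ k, (1 - Λ)⁻¹ i k * Λ k j := by
  have h := congrFun (congrFun (Matrix.nonsing_inv_mul _ (hΛ.isUnit_det_one_sub hD)) i) j
  rw [mul_sub, mul_one, Matrix.sub_apply, Matrix.mul_apply] at h
  linarith

/-- Removing an edge into `b` does not change the columns of `(1 - Λ)⁻¹` indexed by
non-descendants of `b`. -/
theorem DSupported.inv_one_sub_removeEdge_apply {D : Set (Fin n × Fin n)}
    (hD : ∀ i j : Fin n, (i, j) ∈ D → i < j) {Λ : Matrix (Fin n) (Fin n) ℝ}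
    (hΛ : DSupported D Λ) (astar b i c : Fin n) (hc : c ∉ desc D b) :
    (1 - EdgeIntervention.removeEdge Λ astar b)⁻¹ i c = (1 - Λ)⁻¹ i c := by
  induction c using WellFoundedLT.induction with
  | ind c ih =>
    rw [(hΛ.removeEdge astar b).inv_one_sub_apply hD i c, hΛ.inv_one_sub_apply hD i c]
    congr 1
    refine Finset.sum_congr rfl fun k _ => ?_
    have hcb : c ≠ b := fun h => hc (h ▸ Relation.ReflTransGen.refl)
    have hentry : EdgeIntervention.removeEdge Λ astar b k c = Λ k c := by
      simp [EdgeIntervention.removeEdge, hcb]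
    rw [hentry]
    by_cases hk : (k, c) ∈ D
    · rw [ih k (hD k c hk) fun hkb => hc (Relation.ReflTransGen.tail hkb hk)]
    · simp [hΛ k c hk]

/-- after removing the directed edge `a⋆ → b`, the covariance matrix restricted
to the non-descendants of `b` is unchanged. -/
theorem remove_edge_cov_nd_nd (n : ℕ) (D B : Set (Fin n × Fin n))
    (hD : ∀ i j : Fin n, (i, j) ∈ D → i < j)
    (hBsymm : ∀ i j : Fin n, (i, j) ∈ B → (j, i) ∈ B)
    (hBirr : ∀ i : Fin n, (i, i) ∉ B)
    (Λ Ω : Matrix (Fin n) (Fin n) ℝ)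
    (hΛ : DSupported D Λ) (hΩ : BCompatible B Ω)
    (astar b : Fin n) (hab : (astar, b) ∈ D) :
    ∀ a a' : Fin n, a ∉ desc D b → a' ∉ desc D b →
      cov (removeEdge Λ astar b) Ω a a' = cov Λ Ω a a' := by
  intro a a' ha ha'
  simp only [cov, Matrix.mul_apply, Matrix.transpose_apply,
    hΛ.inv_one_sub_removeEdge_apply hD astar b _ a ha,
    hΛ.inv_one_sub_removeEdge_apply hD astar b _ a' ha']

end EdgeIntervention
end

section
/- After removing the directed edge a⋆ → b, for all c, c' ∈ de(b) with c ≠ b and c' ≠ b one has Σ⋆ c c' = Σ c c' − λ Σ a⋆ c · (P b c') − λ Σ a⋆ c' · (P b c) + λ² Σ a⋆ a⋆ · (P b c) · (P b c'), where P = (1 − Λ)⁻¹. -/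
open Matrix

attribute [local instance] Classical.propDecidable

namespace EdgeIntervention

variable {n : ℕ}

/-- The determinant of `1 - Λ` is `1`. -/
theorem det_one_sub {D : Set (Fin n × Fin n)} (hD : ∀ i j : Fin n, (i, j) ∈ D → i < j)
    {Λ : Matrix (Fin n) (Fin n) ℝ} (hΛ : DSupported D Λ) : (1 - Λ).det = 1 := by
  have hdiag : ∀ i, Λ i i = 0 := fun i => hΛ i i fun h => lt_irrefl i (hD i i h)
  have hlower : (1 - Λ).BlockTriangular id :=
    blockTriangular_one.sub fun i j hij => hΛ i j fun h => lt_asymm (hD i j h) hij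
  rw [det_of_isUpperTriangular hlower]
  simp [hdiag]

/-- The matrix `(1 - Λ)⁻¹` is upper triangular. -/
theorem blockTriangular_inv_one_sub {D : Set (Fin n × Fin n)}
    (hD : ∀ i j : Fin n, (i, j) ∈ D → i < j)
    {Λ : Matrix (Fin n) (Fin n) ℝ} (hΛ : DSupported D Λ) :
    (1 - Λ)⁻¹.BlockTriangular (id : Fin n → Fin n) := by
  let _ := invertibleOfIsUnitDet (1 - Λ) (by simp [det_one_sub hD hΛ])
  exact blockTriangular_inv_of_blockTriangular <|
    blockTriangular_one.sub fun i j hij => hΛ i j fun h => lt_asymm (hD i j h) hij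

theorem removeEdge_eq_sub_single (Λ : Matrix (Fin n) (Fin n) ℝ) (a b : Fin n) :
    removeEdge Λ a b = Λ - single a b (Λ a b) := by
  ext i j
  by_cases h : i = a ∧ j = b
  · obtain ⟨rfl, rfl⟩ := h
    simp [removeEdge]
  · have h' : ¬ (a = i ∧ b = j) := fun h' => h ⟨h'.1.symm, h'.2.symm⟩
    simp [removeEdge, single, h, h']

/-- Removing an edge changes `(1 - Λ)⁻¹` by a matrix of rank at most one. -/
theorem inv_one_sub_removeEdge {D : Set (Fin n × Fin n)}
    (hD : ∀ i j : Fin n, (i, j) ∈ D → i < j)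
    {Λ : Matrix (Fin n) (Fin n) ℝ} (hΛ : DSupported D Λ) {a b : Fin n} (hab : a < b) :
    (1 - removeEdge Λ a b)⁻¹
      = (1 - Λ)⁻¹ - (1 - Λ)⁻¹ * (single a b (Λ a b) * (1 - Λ)⁻¹) := by
  have hP : (1 - Λ) * (1 - Λ)⁻¹ = 1 := mul_nonsing_inv _ (by simp [det_one_sub hD hΛ])
  have hE : single a b (Λ a b) * (1 - Λ)⁻¹ * single a b (Λ a b) = 0 := by
    rw [single_mul_mul_single, blockTriangular_inv_one_sub hD hΛ hab]
    simp
  rw [removeEdge_eq_sub_single]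
  apply inv_eq_right_inv
  generalize single a b (Λ a b) = E at hE ⊢
  generalize (1 - Λ)⁻¹ = P at hP hE ⊢
  calc (1 - (Λ - E)) * (P - P * (E * P))
      = (1 - Λ) * P - (1 - Λ) * P * E * P + E * P - E * P * E * P := by noncomm_ring
    _ = 1 := by rw [hP, hE]; simp

theorem cov_apply_comm {Λ Ω : Matrix (Fin n) (Fin n) ℝ} (hΩ : Ω.IsSymm) (i j : Fin n) :
    cov Λ Ω i j = cov Λ Ω j i := by
  have h : (cov Λ Ω)ᵀ = cov Λ Ω := by
    simp [cov, transpose_mul, hΩ.eq, Matrix.mul_assoc]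
  exact congrFun (congrFun h j) i

theorem mul_single_mul_apply (A C : Matrix (Fin n) (Fin n) ℝ) (a b : Fin n) (r : ℝ)
    (i j : Fin n) : (A * (single a b r * C)) i j = A i a * r * C b j := by
  rw [← Matrix.mul_assoc, mul_apply, Finset.sum_eq_single b]
  · rw [mul_single_apply_same]
  · intro k _ hk
    rw [mul_single_apply_of_ne _ _ _ _ _ hk, zero_mul]
  · simp

/-- after removing the directed edge `a⋆ → b`, for all `c, c' ∈ de(b)` distinct
from `b`, `Σ⋆ c c' = Σ c c' − λ Σ a⋆ c (P b c') − λ Σ a⋆ c' (P b c)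
+ λ² Σ a⋆ a⋆ (P b c)(P b c')` with `P = (1 − Λ)⁻¹`. -/
theorem remove_edge_cov_c_c (n : ℕ) (D B : Set (Fin n × Fin n))
    (hD : ∀ i j : Fin n, (i, j) ∈ D → i < j)
    (hBsymm : ∀ i j : Fin n, (i, j) ∈ B → (j, i) ∈ B)
    (hBirr : ∀ i : Fin n, (i, i) ∉ B)
    (Λ Ω : Matrix (Fin n) (Fin n) ℝ)
    (hΛ : DSupported D Λ) (hΩ : BCompatible B Ω)
    (astar b : Fin n) (hab : (astar, b) ∈ D) :
    ∀ c c' : Fin n, c ∈ desc D b → c ≠ b → c' ∈ desc D b → c' ≠ b →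
      cov (removeEdge Λ astar b) Ω c c'
        = cov Λ Ω c c'
          - Λ astar b * cov Λ Ω astar c * (1 - Λ)⁻¹ b c'
          - Λ astar b * cov Λ Ω astar c' * (1 - Λ)⁻¹ b c
          + (Λ astar b) ^ 2 * cov Λ Ω astar astar * (1 - Λ)⁻¹ b c * (1 - Λ)⁻¹ b c' := by
  intro c c' _ _ _ _
  have h : cov (removeEdge Λ astar b) Ω
      = cov Λ Ω - cov Λ Ω * (single astar b (Λ astar b) * (1 - Λ)⁻¹)
        - (cov Λ Ω * (single astar b (Λ astar b) * (1 - Λ)⁻¹))ᵀ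
        + (cov Λ Ω * (single astar b (Λ astar b) * (1 - Λ)⁻¹))ᵀ
          * (single astar b (Λ astar b) * (1 - Λ)⁻¹) := by
    simp only [cov, inv_one_sub_removeEdge hD hΛ (hD _ _ hab)]
    generalize single astar b (Λ astar b) * (1 - Λ)⁻¹ = F
    simp only [transpose_sub, transpose_mul, transpose_transpose, hΩ.1.eq]
    noncomm_ring
  rw [h]
  simp only [Matrix.add_apply, Matrix.sub_apply, transpose_apply, mul_single_mul_apply]
  rw [cov_apply_comm hΩ.1 c astar, cov_apply_comm hΩ.1 c' astar]
  ring

end EdgeIntervention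
end
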